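/- arXiv:2204.00841 — 3 statements merged into one kernel-verified Lean document; each statement's English description precedes it below -/
import Mathlib

section
/- For u, v in the Lobachevsky space with hyperbolic angle λ (cosh λ = u·v), the Hermitian form (f̃^{|u⟩}, f̃^{|v⟩})_𝔍 = -∫_{S²} \overline{f̃^{|u⟩}_μ(p)} f̃^{|v⟩,μ}(p) d²p, where f̃^{|u⟩}_μ(p) = u_μ/(u·p) and p = (1,n) with n ∈ S², equals -4π λ coth λ (with the value -4π at λ = 0). -/
open MeasureTheory

/-- Minkowski bilinear form on `ℝ⁴` with signature `(+,-,-,-)`. -/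
def mink (u v : Fin 4 → ℝ) : ℝ :=
  u 0 * v 0 - u 1 * v 1 - u 2 * v 2 - u 3 * v 3

/-- `u · p` for `p = (1, n)` on the forward light cone, `n ∈ S² ⊂ ℝ³`. -/
def minkp (u : Fin 4 → ℝ) (n : EuclideanSpace ℝ (Fin 3)) : ℝ :=
  u 0 - u 1 * n 0 - u 2 * n 1 - u 3 * n 2

/-- `λ coth λ`, interpreted as `1` at `λ = 0`. -/
noncomputable def lcoth (l : ℝ) : ℝ :=
  if l = 0 then 1 else l * (Real.cosh l / Real.sinh l)

/-- The surface measure on the unit sphere `S² ⊂ ℝ³` (total mass `4π`). -/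
noncomputable def sphereMeasure :
    Measure (Metric.sphere (0 : EuclideanSpace ℝ (Fin 3)) 1) :=
  (volume : Measure (EuclideanSpace ℝ (Fin 3))).toSphere

theorem lintegral_Ioi_mul_exp_neg_sqrt_div {c : ℝ} (hc : 0 < c) (z : ℝ) :
    ∫⁻ ρ in Set.Ioi (0 : ℝ), ENNReal.ofReal
        (ρ * (Real.exp (-(c * √(ρ ^ 2 + z ^ 2))) / √(ρ ^ 2 + z ^ 2))) =
      ENNReal.ofReal (Real.exp (-(c * |z|)) / c) := by
  have hcont : ContinuousWithinAt (fun ρ : ℝ => -(Real.exp (-(c * √(ρ ^ 2 + z ^ 2))) / c))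
      (Set.Ici 0) 0 := by
    apply Continuous.continuousWithinAt
    fun_prop
  have hderiv : ∀ ρ ∈ Set.Ioi (0 : ℝ),
      HasDerivAt (fun ρ : ℝ => -(Real.exp (-(c * √(ρ ^ 2 + z ^ 2))) / c))
        (ρ * (Real.exp (-(c * √(ρ ^ 2 + z ^ 2))) / √(ρ ^ 2 + z ^ 2))) ρ := by
    intro ρ hρ
    have hρ' : 0 < ρ := hρ
    have hpos : 0 < ρ ^ 2 + z ^ 2 := by positivity
    have h := ((((((hasDerivAt_id ρ).pow 2).add_const (z ^ 2)).sqrt hpos.ne').const_mul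
      c).neg.exp.div_const c).neg
    convert! h using 1
    have := Real.sqrt_pos.2 hpos
    simp
    field_simp
  have hnonneg : ∀ ρ ∈ Set.Ioi (0 : ℝ),
      0 ≤ ρ * (Real.exp (-(c * √(ρ ^ 2 + z ^ 2))) / √(ρ ^ 2 + z ^ 2)) := by
    intro ρ hρ
    have hρ' : 0 < ρ := hρ
    positivity
  have hlim : Filter.Tendsto (fun ρ : ℝ => -(Real.exp (-(c * √(ρ ^ 2 + z ^ 2))) / c))
      Filter.atTop (nhds 0) := by
    have h1 : Filter.Tendsto (fun ρ : ℝ => c * √(ρ ^ 2 + z ^ 2)) Filter.atTop Filter.atTop := by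
      apply Filter.Tendsto.const_mul_atTop hc
      apply Filter.tendsto_atTop_mono (f := fun ρ : ℝ => ρ) _ Filter.tendsto_id
      intro ρ
      apply Real.le_sqrt_of_sq_le
      nlinarith [sq_nonneg z]
    have h2 := ((Real.tendsto_exp_neg_atTop_nhds_zero.comp h1).div_const c).neg
    simpa using h2
  rw [← ofReal_integral_eq_lintegral_ofReal
      (integrableOn_Ioi_deriv_of_nonneg hcont hderiv hnonneg hlim)
      (ae_restrict_of_forall_mem measurableSet_Ioi hnonneg),
    integral_Ioi_of_hasDerivAt_of_nonneg hcont hderiv hnonneg hlim]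
  simp [Real.sqrt_sq_eq_abs]

theorem lintegral_prod_exp_neg_sqrt_div {c : ℝ} (hc : 0 < c) (z : ℝ) :
    ∫⁻ p : ℝ × ℝ, ENNReal.ofReal (Real.exp (-(c * √(p.1 ^ 2 + p.2 ^ 2 + z ^ 2))) /
        √(p.1 ^ 2 + p.2 ^ 2 + z ^ 2)) =
      ENNReal.ofReal (2 * Real.pi / c * Real.exp (-(c * |z|))) := by
  rw [← lintegral_comp_polarCoord_symm, polarCoord_target, Measure.volume_eq_prod,
    ← Measure.prod_restrict]
  have h : ∀ p : ℝ × ℝ, ENNReal.ofReal p.1 • ENNReal.ofReal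
      (Real.exp (-(c * √((polarCoord.symm p).1 ^ 2 + (polarCoord.symm p).2 ^ 2 + z ^ 2))) /
        √((polarCoord.symm p).1 ^ 2 + (polarCoord.symm p).2 ^ 2 + z ^ 2)) =
      ENNReal.ofReal (p.1 * (Real.exp (-(c * √(p.1 ^ 2 + z ^ 2))) / √(p.1 ^ 2 + z ^ 2))) *
        (fun _ => 1) p.2 := by
    intro p
    have : (polarCoord.symm p).1 ^ 2 + (polarCoord.symm p).2 ^ 2 = p.1 ^ 2 := by
      simp only [polarCoord_symm_apply]
      linear_combination p.1 ^ 2 * Real.cos_sq_add_sin_sq p.2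
    rw [this, smul_eq_mul, ← ENNReal.ofReal_mul' (by positivity), mul_one]
  rw [lintegral_congr h, lintegral_prod_mul (f := fun ρ => ENNReal.ofReal
    (ρ * (Real.exp (-(c * √(ρ ^ 2 + z ^ 2))) / √(ρ ^ 2 + z ^ 2)))) (g := fun _ => 1)
    (by fun_prop) (by fun_prop), lintegral_Ioi_mul_exp_neg_sqrt_div hc]
  simp only [lintegral_const, Measure.restrict_apply MeasurableSet.univ, Set.univ_inter,
    Real.volume_Ioo, one_mul]
  rw [← ENNReal.ofReal_mul (by positivity)]
  congr 1
  ring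

theorem lintegral_exp_mul_sub_mul_abs {b c : ℝ} (hbc : |b| < c) :
    ∫⁻ z : ℝ, ENNReal.ofReal (Real.exp (b * z - c * |z|)) =
      ENNReal.ofReal (2 * c / (c ^ 2 - b ^ 2)) := by
  obtain ⟨h1, h2⟩ := abs_lt.1 hbc
  rw [← lintegral_add_compl _ (measurableSet_Iic (a := (0 : ℝ))), Set.compl_Iic,
    setLIntegral_congr_fun (g := fun z => ENNReal.ofReal (Real.exp ((b + c) * z)))
      measurableSet_Iic (fun z hz => by
        simp only [abs_of_nonpos (show z ≤ 0 from hz)]; congr 2; ring),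
    setLIntegral_congr_fun (g := fun z => ENNReal.ofReal (Real.exp ((b - c) * z)))
      measurableSet_Ioi (fun z hz => by
        simp only [abs_of_pos (show 0 < z from hz)]; congr 2; ring),
    ← ofReal_integral_eq_lintegral_ofReal (integrableOn_exp_mul_Iic (by linarith) _)
      (ae_of_all _ fun _ => Real.exp_nonneg _),
    ← ofReal_integral_eq_lintegral_ofReal (integrableOn_exp_mul_Ioi (by linarith) _)
      (ae_of_all _ fun _ => Real.exp_nonneg _),
    integral_exp_mul_Iic (by linarith), integral_exp_mul_Ioi (by linarith)]
  simp only [mul_zero, Real.exp_zero]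
  have e1 : b + c ≠ 0 := by linarith
  have e2 : b - c ≠ 0 := by linarith
  have e3 : c - b ≠ 0 := by linarith
  have e4 : c ^ 2 - b ^ 2 ≠ 0 := by
    rw [show c ^ 2 - b ^ 2 = (b + c) * (c - b) by ring]; exact mul_ne_zero e1 e3
  rw [← ENNReal.ofReal_add (by apply div_nonneg <;> linarith)
    (by rw [← neg_sub c b, neg_div_neg_eq]; apply div_nonneg <;> linarith)]
  congr 1
  field_simp
  ring

theorem measurePreserving_euclideanSpace_three :
    MeasurePreserving (fun x : EuclideanSpace ℝ (Fin 3) => (x 0, (x 1, x 2))) := by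
  have h1 := PiLp.volume_preserving_ofLp (Fin 3)
  have h2 := volume_preserving_piFinSuccAbove (fun _ : Fin 3 => ℝ) 0
  have h3 : MeasurePreserving (Prod.map (id : ℝ → ℝ) (@MeasurableEquiv.finTwoArrow ℝ _)) :=
    (MeasurePreserving.id volume).prod (volume_preserving_finTwoArrow ℝ)
  exact h3.comp (h2.comp h1)

theorem lintegral_exp_neg_norm_sub_inner_div_norm {c : ℝ} {b : EuclideanSpace ℝ (Fin 3)}
    (hbc : ‖b‖ < c) :
    ∫⁻ x : EuclideanSpace ℝ (Fin 3),
        ENNReal.ofReal (Real.exp (-(c * ‖x‖ - inner ℝ b x)) / ‖x‖) =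
      ENNReal.ofReal (4 * Real.pi / (c ^ 2 - ‖b‖ ^ 2)) := by
  have hc : 0 < c := (norm_nonneg b).trans_lt hbc
  obtain ⟨e, he, hbe⟩ : ∃ e : EuclideanSpace ℝ (Fin 3), ‖e‖ = 1 ∧ b = ‖b‖ • e := by
    by_cases hb : b = 0
    · exact ⟨EuclideanSpace.single 0 1, by simp, by simp [hb]⟩
    · exact ⟨‖b‖⁻¹ • b, norm_smul_inv_norm hb, by
        rw [smul_smul, mul_inv_cancel₀ (norm_ne_zero_iff.2 hb), one_smul]⟩
  obtain ⟨B, hB⟩ := Orthonormal.exists_orthonormalBasis_extension_of_card_eq (𝕜 := ℝ)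
    (E := EuclideanSpace ℝ (Fin 3)) (ι := Fin 3) (by simp) (v := fun _ => e) (s := {0}) (by
      rw [orthonormal_iff_ite]
      rintro ⟨i, rfl⟩ ⟨j, rfl⟩
      simp [he])
  have hmp := measurePreserving_euclideanSpace_three.comp B.measurePreserving_repr
  let f : ℝ × ℝ × ℝ → ENNReal := fun q => ENNReal.ofReal (Real.exp (‖b‖ * q.1)) *
    ENNReal.ofReal (Real.exp (-(c * √(q.2.1 ^ 2 + q.2.2 ^ 2 + q.1 ^ 2))) /
      √(q.2.1 ^ 2 + q.2.2 ^ 2 + q.1 ^ 2))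
  have hf : Measurable f := by fun_prop
  have hx : ∀ x : EuclideanSpace ℝ (Fin 3),
      ENNReal.ofReal (Real.exp (-(c * ‖x‖ - inner ℝ b x)) / ‖x‖) =
      f (((fun x : EuclideanSpace ℝ (Fin 3) => (x 0, (x 1, x 2))) ∘ B.repr) x) := by
    intro x
    have hin : inner ℝ b x = ‖b‖ * B.repr x 0 := by
      rw [B.repr_apply_apply, hB 0 rfl]
      conv_lhs => rw [hbe]
      rw [real_inner_smul_left]
    have hn : ‖x‖ = √(B.repr x 1 ^ 2 + B.repr x 2 ^ 2 + B.repr x 0 ^ 2) := by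
      rw [← B.repr.norm_map x, EuclideanSpace.norm_eq, Fin.sum_univ_three]
      simp only [Real.norm_eq_abs, sq_abs]
      congr 1
      ring
    simp only [f, Function.comp_apply]
    rw [← ENNReal.ofReal_mul (Real.exp_nonneg _), ← hn, hin, ← mul_div_assoc, ← Real.exp_add]
    congr 3
    ring
  simp_rw [hx]
  rw [hmp.lintegral_comp hf, Measure.volume_eq_prod, lintegral_prod _ hf.aemeasurable]
  simp only [f]
  have hz : ∀ z : ℝ, ENNReal.ofReal (Real.exp (‖b‖ * z)) *
      ENNReal.ofReal (2 * Real.pi / c * Real.exp (-(c * |z|))) =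
      ENNReal.ofReal (2 * Real.pi / c) * ENNReal.ofReal (Real.exp (‖b‖ * z - c * |z|)) := by
    intro z
    rw [← ENNReal.ofReal_mul (by positivity), ← ENNReal.ofReal_mul (by positivity),
      sub_eq_add_neg, Real.exp_add]
    congr 1
    ring
  simp_rw [lintegral_const_mul' _ _ ENNReal.ofReal_ne_top, lintegral_prod_exp_neg_sqrt_div hc, hz]
  rw [lintegral_const_mul' _ _ ENNReal.ofReal_ne_top,
    lintegral_exp_mul_sub_mul_abs (by rwa [abs_of_nonneg (norm_nonneg b)]),
    ← ENNReal.ofReal_mul (by positivity)]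
  congr 1
  field_simp
  ring

theorem lintegral_eq_lintegral_toSphere {E : Type*} [NormedAddCommGroup E] [NormedSpace ℝ E]
    [FiniteDimensional ℝ E] [Nontrivial E] [MeasurableSpace E] [BorelSpace E]
    (μ : Measure E) [μ.IsAddHaarMeasure] {f : E → ENNReal} (hf : Measurable f) :
    ∫⁻ x, f x ∂μ = ∫⁻ n : Metric.sphere (0 : E) 1, (∫⁻ r in Set.Ioi (0 : ℝ),
      ENNReal.ofReal (r ^ (Module.finrank ℝ E - 1)) * f (r • (n : E))) ∂μ.toSphere := by
  have hmp := μ.measurePreserving_homeomorphUnitSphereProd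
  have hg : Measurable fun q : Metric.sphere (0 : E) 1 × Set.Ioi (0 : ℝ) =>
      f ((q.2 : ℝ) • (q.1 : E)) := by fun_prop
  calc ∫⁻ x, f x ∂μ = ∫⁻ x in ({0}ᶜ : Set E), f x ∂μ := by
        rw [restrict_compl_singleton]
    _ = ∫⁻ x : ({0}ᶜ : Set E), f x ∂μ.comap (↑) :=
        (lintegral_subtype_comap (measurableSet_singleton _).compl f).symm
    _ = ∫⁻ q, f ((q.2 : ℝ) • (q.1 : E)) ∂μ.toSphere.prod
          (Measure.volumeIoiPow (Module.finrank ℝ E - 1)) := by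
        rw [← hmp.lintegral_comp hg]
        refine lintegral_congr fun x => ?_
        congr 1
        have hx : ‖(x : E)‖ ≠ 0 := norm_ne_zero_iff.2 x.2
        simp [smul_smul, hx]
    _ = _ := by
        rw [lintegral_prod _ hg.aemeasurable]
        refine lintegral_congr fun n => ?_
        rw [Measure.volumeIoiPow, lintegral_withDensity_eq_lintegral_mul _ (by fun_prop)
          (by fun_prop)]
        exact lintegral_subtype_comap measurableSet_Ioi
          (fun r : ℝ => ENNReal.ofReal (r ^ (Module.finrank ℝ E - 1)) * f (r • (n : E)))

theorem lintegral_toSphere_one_div_sub_inner_sq {c : ℝ} {b : EuclideanSpace ℝ (Fin 3)}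
    (hbc : ‖b‖ < c) :
    ∫⁻ n : Metric.sphere (0 : EuclideanSpace ℝ (Fin 3)) 1,
        ENNReal.ofReal (1 / (c - inner ℝ b (n : EuclideanSpace ℝ (Fin 3))) ^ 2)
        ∂(volume : Measure (EuclideanSpace ℝ (Fin 3))).toSphere =
      ENNReal.ofReal (4 * Real.pi / (c ^ 2 - ‖b‖ ^ 2)) := by
  rw [← lintegral_exp_neg_norm_sub_inner_div_norm hbc,
    lintegral_eq_lintegral_toSphere (E := EuclideanSpace ℝ (Fin 3)) _ (by fun_prop)]
  refine lintegral_congr fun n => ?_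
  have hn : ‖(n : EuclideanSpace ℝ (Fin 3))‖ = 1 := norm_eq_of_mem_sphere n
  set a := c - inner ℝ b (n : EuclideanSpace ℝ (Fin 3)) with ha_def
  have ha : 0 < a := by
    have := real_inner_le_norm b (n : EuclideanSpace ℝ (Fin 3))
    rw [hn, mul_one] at this
    linarith
  have hG := Real.integral_rpow_mul_exp_neg_mul_Ioi (a := 2) (by norm_num) ha
  have hG2 : Real.Gamma 2 = 1 := by simp
  rw [hG2, mul_one] at hG
  have hint := Integrable.of_integral_ne_zero (by rw [hG]; positivity)
  rw [Real.rpow_two, one_div_pow] at hG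
  rw [← hG, ofReal_integral_eq_lintegral_ofReal hint
    (ae_restrict_of_forall_mem measurableSet_Ioi fun r (hr : 0 < r) => by positivity)]
  refine setLIntegral_congr_fun measurableSet_Ioi fun r (hr : 0 < r) => ?_
  simp only [finrank_euclideanSpace, Fintype.card_fin]
  rw [← ENNReal.ofReal_mul (by positivity), norm_smul, hn, inner_smul_right, Real.norm_eq_abs,
    abs_of_pos hr, mul_one, show c * r - r * inner ℝ b (n : EuclideanSpace ℝ (Fin 3)) = a * r by
      rw [ha_def]; ring, show (2 : ℝ) - 1 = 1 by norm_num, Real.rpow_one]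
  congr 1
  field_simp

theorem intervalIntegral_one_div_segment_sq {x y : ℝ} (hx : 0 < x) (hy : 0 < y) :
    ∫ t in (0 : ℝ)..1, 1 / (t * x + (1 - t) * y) ^ 2 = 1 / (x * y) := by
  have hpos : ∀ t ∈ Set.uIcc (0 : ℝ) 1, 0 < t * x + (1 - t) * y := by
    intro t ht
    rw [Set.uIcc_of_le zero_le_one] at ht
    rcases ht.1.eq_or_lt with h | h
    · subst h; simpa using hy
    · have := mul_pos h hx
      have := mul_nonneg (sub_nonneg.2 ht.2) hy.le
      linarith
  have hd : ∀ t ∈ Set.uIcc (0 : ℝ) 1, HasDerivAt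
      (fun t : ℝ => t / (y * (t * x + (1 - t) * y))) (1 / (t * x + (1 - t) * y) ^ 2) t := by
    intro t ht
    have h0 := hpos t ht
    have hl : HasDerivAt (fun t : ℝ => t * x + (1 - t) * y) (1 * x + (-1) * y) t :=
      ((hasDerivAt_id t).mul_const x).add (((hasDerivAt_id t).const_sub 1).mul_const y)
    have := (hasDerivAt_id t).div (hl.const_mul y) (mul_pos hy h0).ne'
    convert! this using 1
    simp only [id]
    field_simp
    ring
  rw [intervalIntegral.integral_eq_sub_of_hasDerivAt hd]
  · simp
    ring
  · apply ContinuousOn.intervalIntegrable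
    exact continuousOn_const.div (by fun_prop) fun t ht => (pow_pos (hpos t ht) 2).ne'

theorem segment_quadratic_eq_mul (l t : ℝ) :
    t ^ 2 + (1 - t) ^ 2 + 2 * t * (1 - t) * Real.cosh l =
      (t + (1 - t) * Real.exp l) * (t + (1 - t) * Real.exp (-l)) := by
  have h : Real.exp l * Real.exp (-l) = 1 := by rw [← Real.exp_add]; simp
  rw [Real.cosh_eq]
  linear_combination -(1 - t) ^ 2 * h

theorem segment_quadratic_pos {c : ℝ} (hc : 1 ≤ c) {t : ℝ} (ht : t ∈ Set.Icc (0 : ℝ) 1) :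
    0 < t ^ 2 + (1 - t) ^ 2 + 2 * t * (1 - t) * c := by
  have := mul_nonneg ht.1 (sub_nonneg.2 ht.2)
  nlinarith

theorem cosh_mul_intervalIntegral_one_div_segment_quadratic (l : ℝ) :
    Real.cosh l * ∫ t in (0 : ℝ)..1,
      1 / (t ^ 2 + (1 - t) ^ 2 + 2 * t * (1 - t) * Real.cosh l) = lcoth l := by
  unfold lcoth
  split_ifs with hl
  · have : ∀ t : ℝ, t ^ 2 + (1 - t) ^ 2 + 2 * t * (1 - t) * Real.cosh l = 1 := by
      intro t; rw [hl, Real.cosh_zero]; ring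
    simp_rw [this]
    simp [hl]
  have hs : Real.sinh l ≠ 0 := by simpa using hl
  have hlin : ∀ m : ℝ, ∀ t ∈ Set.uIcc (0 : ℝ) 1, 0 < t + (1 - t) * Real.exp m := by
    intro m t ht
    rw [Set.uIcc_of_le zero_le_one] at ht
    rcases ht.1.eq_or_lt with h | h
    · subst h; simpa using Real.exp_pos m
    · have := mul_nonneg (sub_nonneg.2 ht.2) (Real.exp_pos m).le
      linarith
  have hlog : ∀ m : ℝ, ∀ t ∈ Set.uIcc (0 : ℝ) 1, HasDerivAt
      (fun t : ℝ => Real.log (t + (1 - t) * Real.exp m))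
      ((1 + (-1) * Real.exp m) / (t + (1 - t) * Real.exp m)) t := fun m t ht =>
    ((hasDerivAt_id t).add (((hasDerivAt_id t).const_sub 1).mul_const _)).log (hlin m t ht).ne'
  have hd : ∀ t ∈ Set.uIcc (0 : ℝ) 1, HasDerivAt
      (fun t : ℝ => (Real.log (t + (1 - t) * Real.exp (-l)) -
        Real.log (t + (1 - t) * Real.exp l)) / (2 * Real.sinh l))
      (1 / (t ^ 2 + (1 - t) ^ 2 + 2 * t * (1 - t) * Real.cosh l)) t := by
    intro t ht
    have h1 := hlin l t ht
    have h2 := hlin (-l) t ht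
    convert! ((hlog (-l) t ht).sub (hlog l t ht)).div_const (2 * Real.sinh l) using 1
    rw [segment_quadratic_eq_mul]
    rw [div_sub_div _ _ h2.ne' h1.ne', div_div, div_eq_div_iff (by positivity) (by positivity),
      Real.sinh_eq]
    ring
  rw [intervalIntegral.integral_eq_sub_of_hasDerivAt hd]
  · simp
    field_simp
    ring
  · apply ContinuousOn.intervalIntegrable
    refine continuousOn_const.div (by fun_prop) fun t ht => ?_
    rw [segment_quadratic_eq_mul]
    exact (mul_pos (hlin l t ht) (hlin (-l) t ht)).ne'

/-- The spatial part of a four-vector. -/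
noncomputable def spatial (u : Fin 4 → ℝ) : EuclideanSpace ℝ (Fin 3) := !₂[u 1, u 2, u 3]

theorem minkp_eq_sub_inner (u : Fin 4 → ℝ) (n : EuclideanSpace ℝ (Fin 3)) :
    minkp u n = u 0 - inner ℝ (spatial u) n := by
  simp [minkp, spatial, PiLp.inner_apply, Fin.sum_univ_three]
  ring

theorem mink_self_eq_sub_norm_sq (u : Fin 4 → ℝ) :
    mink u u = u 0 ^ 2 - ‖spatial u‖ ^ 2 := by
  simp [mink, spatial, EuclideanSpace.norm_sq_eq, Fin.sum_univ_three]
  ring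

theorem norm_spatial_lt {u : Fin 4 → ℝ} (hu : 0 < mink u u) (hu0 : 0 < u 0) :
    ‖spatial u‖ < u 0 := by
  rw [mink_self_eq_sub_norm_sq] at hu
  exact lt_of_pow_lt_pow_left₀ 2 hu0.le (by linarith)

theorem minkp_pos {u : Fin 4 → ℝ} (hu : 0 < mink u u) (hu0 : 0 < u 0)
    (n : Metric.sphere (0 : EuclideanSpace ℝ (Fin 3)) 1) :
    0 < minkp u (n : EuclideanSpace ℝ (Fin 3)) := by
  rw [minkp_eq_sub_inner]
  have h1 := real_inner_le_norm (spatial u) (n : EuclideanSpace ℝ (Fin 3))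
  rw [norm_eq_of_mem_sphere n, mul_one] at h1
  linarith [norm_spatial_lt hu hu0]

theorem continuous_minkp (u : Fin 4 → ℝ) : Continuous (minkp u) := by
  unfold minkp
  fun_prop

theorem lintegral_sphereMeasure_one_div_minkp_sq {w : Fin 4 → ℝ} (hw : 0 < mink w w)
    (hw0 : 0 < w 0) :
    ∫⁻ n : Metric.sphere (0 : EuclideanSpace ℝ (Fin 3)) 1,
        ENNReal.ofReal (1 / minkp w (n : EuclideanSpace ℝ (Fin 3)) ^ 2) ∂sphereMeasure =
      ENNReal.ofReal (4 * Real.pi / mink w w) := by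
  simp_rw [minkp_eq_sub_inner, mink_self_eq_sub_norm_sq]
  exact lintegral_toSphere_one_div_sub_inner_sq (norm_spatial_lt hw hw0)

theorem lintegral_Ioc_one_div_segment_sq {x y : ℝ} (hx : 0 < x) (hy : 0 < y) :
    ∫⁻ t in Set.Ioc (0 : ℝ) 1, ENNReal.ofReal (1 / (t * x + (1 - t) * y) ^ 2) =
      ENNReal.ofReal (1 / (x * y)) := by
  rw [← intervalIntegral_one_div_segment_sq hx hy, intervalIntegral.integral_of_le zero_le_one,
    ofReal_integral_eq_lintegral_ofReal _ (ae_of_all _ fun t => by positivity)]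
  refine Integrable.of_integral_ne_zero ?_
  rw [← intervalIntegral.integral_of_le zero_le_one, intervalIntegral_one_div_segment_sq hx hy]
  positivity

theorem lintegral_sphereMeasure_one_div_minkp_mul_minkp {u v : Fin 4 → ℝ}
    (hu : mink u u = 1) (hu0 : 0 < u 0) (hv : mink v v = 1) (hv0 : 0 < v 0)
    (huv : 1 ≤ mink u v) :
    ∫⁻ n : Metric.sphere (0 : EuclideanSpace ℝ (Fin 3)) 1,
        ENNReal.ofReal (1 / (minkp u (n : EuclideanSpace ℝ (Fin 3)) *
          minkp v (n : EuclideanSpace ℝ (Fin 3)))) ∂sphereMeasure =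
      ENNReal.ofReal (4 * Real.pi * ∫ t in (0 : ℝ)..1,
        1 / (t ^ 2 + (1 - t) ^ 2 + 2 * t * (1 - t) * mink u v)) := by
  have : IsFiniteMeasure sphereMeasure := by unfold sphereMeasure; infer_instance
  have hseg : ∀ t, ∀ n : EuclideanSpace ℝ (Fin 3),
      minkp (t • u + (1 - t) • v) n = t * minkp u n + (1 - t) * minkp v n := by
    intro t n
    simp only [minkp, Pi.add_apply, Pi.smul_apply, smul_eq_mul]
    ring
  have hquad : ∀ t : ℝ, mink (t • u + (1 - t) • v) (t • u + (1 - t) • v) =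
      t ^ 2 + (1 - t) ^ 2 + 2 * t * (1 - t) * mink u v := by
    intro t
    rw [show t ^ 2 + (1 - t) ^ 2 + 2 * t * (1 - t) * mink u v =
      t ^ 2 * mink u u + (1 - t) ^ 2 * mink v v + 2 * t * (1 - t) * mink u v by
        rw [hu, hv]; ring]
    simp only [mink, Pi.add_apply, Pi.smul_apply, smul_eq_mul]
    ring
  have hmeas : Measurable fun q : Metric.sphere (0 : EuclideanSpace ℝ (Fin 3)) 1 × ℝ =>
      ENNReal.ofReal (1 / (q.2 * minkp u (q.1 : EuclideanSpace ℝ (Fin 3)) +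
        (1 - q.2) * minkp v (q.1 : EuclideanSpace ℝ (Fin 3))) ^ 2) := by
    have := (continuous_minkp u).measurable
    have := (continuous_minkp v).measurable
    fun_prop
  simp_rw [← fun n : Metric.sphere (0 : EuclideanSpace ℝ (Fin 3)) 1 =>
    lintegral_Ioc_one_div_segment_sq (minkp_pos (hu ▸ one_pos) hu0 n)
      (minkp_pos (hv ▸ one_pos) hv0 n)]
  rw [lintegral_lintegral_swap hmeas.aemeasurable, ← intervalIntegral.integral_const_mul,
    intervalIntegral.integral_of_le zero_le_one, ofReal_integral_eq_lintegral_ofReal]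
  · refine setLIntegral_congr_fun measurableSet_Ioc fun t ht => ?_
    have ht' : t ∈ Set.Icc (0 : ℝ) 1 := Set.Ioc_subset_Icc_self ht
    simp_rw [← hseg]
    rw [lintegral_sphereMeasure_one_div_minkp_sq, hquad, mul_one_div]
    · rw [hquad]
      exact segment_quadratic_pos huv ht'
    · have := mul_pos ht.1 hu0
      have := mul_nonneg (sub_nonneg.2 ht.2) hv0.le
      simp only [Pi.add_apply, Pi.smul_apply, smul_eq_mul]
      linarith
  · refine (ContinuousOn.integrableOn_Icc ?_).mono_set Set.Ioc_subset_Icc_self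
    exact continuousOn_const.mul (continuousOn_const.div (by fun_prop) fun t ht =>
      (segment_quadratic_pos huv ht).ne')
  · refine ae_restrict_of_forall_mem measurableSet_Ioc fun t ht => ?_
    have := segment_quadratic_pos huv (Set.Ioc_subset_Icc_self ht)
    positivity

/-- For `u, v` in the Lobachevsky space with hyperbolic angle `λ`
(`cosh λ = u·v`, `λ ≥ 0`), the Hermitian form
`(f̃^{|u⟩}, f̃^{|v⟩})_𝔍 = -∫_{S²} (u·v)/((u·p)(v·p)) d²p`, where
`f̃^{|u⟩}_μ(p) = u_μ/(u·p)` and `p = (1,n)`, equals `-4π λ coth λ`. -/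
theorem hermitian_form_on_dirac_states
    (u v : Fin 4 → ℝ)
    (hu : mink u u = 1) (hu0 : 0 < u 0)
    (hv : mink v v = 1) (hv0 : 0 < v 0)
    (l : ℝ) (hl : 0 ≤ l) (hcosh : Real.cosh l = mink u v) :
    (- ∫ n : Metric.sphere (0 : EuclideanSpace ℝ (Fin 3)) 1,
        mink u v / (minkp u (n : EuclideanSpace ℝ (Fin 3)) *
          minkp v (n : EuclideanSpace ℝ (Fin 3)))
      ∂sphereMeasure)
      = -(4 * Real.pi * lcoth l) := by
  have hc : 1 ≤ mink u v := hcosh ▸ Real.one_le_cosh l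
  have hpos : ∀ n : Metric.sphere (0 : EuclideanSpace ℝ (Fin 3)) 1,
      0 ≤ 1 / (minkp u (n : EuclideanSpace ℝ (Fin 3)) *
        minkp v (n : EuclideanSpace ℝ (Fin 3))) := fun n =>
    one_div_nonneg.2 (mul_pos (minkp_pos (hu ▸ one_pos) hu0 n)
      (minkp_pos (hv ▸ one_pos) hv0 n)).le
  have hmeas : Measurable fun n : Metric.sphere (0 : EuclideanSpace ℝ (Fin 3)) 1 =>
      1 / (minkp u (n : EuclideanSpace ℝ (Fin 3)) *
        minkp v (n : EuclideanSpace ℝ (Fin 3))) := by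
    have := (continuous_minkp u).measurable
    have := (continuous_minkp v).measurable
    fun_prop
  have hI : 0 ≤ ∫ t in (0 : ℝ)..1, 1 / (t ^ 2 + (1 - t) ^ 2 + 2 * t * (1 - t) * mink u v) :=
    intervalIntegral.integral_nonneg zero_le_one fun t ht =>
      one_div_nonneg.2 (segment_quadratic_pos hc ht).le
  simp_rw [← mul_one_div (mink u v)]
  rw [integral_const_mul, integral_eq_lintegral_of_nonneg_ae (ae_of_all _ hpos)
      hmeas.aestronglyMeasurable,
    lintegral_sphereMeasure_one_div_minkp_mul_minkp hu hu0 hv hv0 hc,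
    ENNReal.toReal_ofReal (by positivity), ← hcosh,
    ← cosh_mul_intervalIntegral_one_div_segment_quadratic]
  ring
end

section
/- The kernel K(u,v) = λ(u,v)·coth(λ(u,v)) - 1 on the Lobachevsky space (with λ(u,v) the hyperbolic angle, cosh λ = u·v, and value 0 on the diagonal) is conditionally negative definite: for all n, all u₁,…,u_n in the Lobachevsky space, and all complex α₁,…,α_n with Σαᵢ = 0, Σᵢⱼ \overline{αᵢ}αⱼ K(uᵢ,uⱼ) ≤ 0. -/
open scoped ComplexOrder

/-- The Lobachevsky space `𝓛₃`. -/
def Lob : Set (Fin 4 → ℝ) := {u | mink u u = 1 ∧ 0 < u 0}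

/-- Inverse hyperbolic cosine: `arcosh x = log (x + √(x² - 1))`. -/
noncomputable def arcosh (x : ℝ) : ℝ := Real.log (x + Real.sqrt (x ^ 2 - 1))

/-- The kernel `K(u,v) = λ(u,v) coth λ(u,v) - 1` with `λ(u,v) = arcosh (u·v)`. -/
noncomputable def Kker (u v : Fin 4 → ℝ) : ℝ :=
  lcoth (arcosh (mink u v)) - 1

open MeasureTheory Set Filter Topology

lemma mink_comm (u v : Fin 4 → ℝ) : mink u v = mink v u := by
  simp only [mink]; ring

lemma mink_sum_smul_left {ι : Type*} (s : Finset ι) (c : ι → ℝ) (u : ι → Fin 4 → ℝ)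
    (v : Fin 4 → ℝ) : mink (∑ i ∈ s, c i • u i) v = ∑ i ∈ s, c i * mink (u i) v := by
  simp only [mink, Finset.sum_apply, Pi.smul_apply, smul_eq_mul, Finset.sum_mul,
    ← Finset.sum_sub_distrib]
  exact Finset.sum_congr rfl fun i _ => by ring

lemma mink_sum_smul_right {ι : Type*} (s : Finset ι) (c : ι → ℝ) (u : ι → Fin 4 → ℝ)
    (v : Fin 4 → ℝ) : mink v (∑ i ∈ s, c i • u i) = ∑ i ∈ s, c i * mink v (u i) := by
  rw [mink_comm, mink_sum_smul_left]
  simp only [mink_comm v]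

/-- A vector orthogonal to a future-directed null vector is not timelike. -/
lemma mink_self_nonpos_of_orthogonal_null {w k : Fin 4 → ℝ} (hk : mink k k = 0) (hk0 : 0 < k 0)
    (h : mink w k = 0) : mink w w ≤ 0 := by
  simp only [mink] at *
  have h1 : (w 0 * k 0) ^ 2 = (w 1 * k 1 + w 2 * k 2 + w 3 * k 3) ^ 2 := by
    congr 1; linarith
  have h2 : (w 0 * w 0) * (k 0 * k 0) ≤
      (w 1 * w 1 + w 2 * w 2 + w 3 * w 3) * (k 0 * k 0) := by
    have h3 : k 0 * k 0 = k 1 * k 1 + k 2 * k 2 + k 3 * k 3 := by linarith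
    calc (w 0 * w 0) * (k 0 * k 0) = (w 1 * k 1 + w 2 * k 2 + w 3 * k 3) ^ 2 := by
          rw [← h1]; ring
      _ ≤ _ := by
        rw [h3]
        nlinarith [sq_nonneg (w 1 * k 2 - w 2 * k 1), sq_nonneg (w 1 * k 3 - w 3 * k 1),
          sq_nonneg (w 2 * k 3 - w 3 * k 2)]
  have := le_of_mul_le_mul_right h2 (mul_pos hk0 hk0)
  linarith

/-- The stereographic parametrization of the future-directed null directions. -/
def nullVec (p : ℝ × ℝ) : Fin 4 → ℝ :=
  ![1 + (p.1 ^ 2 + p.2 ^ 2), 2 * p.1, 2 * p.2, p.1 ^ 2 + p.2 ^ 2 - 1]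

lemma mink_nullVec_self (p : ℝ × ℝ) : mink (nullVec p) (nullVec p) = 0 := by
  simp [mink, nullVec]; ring

lemma nullVec_zero_pos (p : ℝ × ℝ) : 0 < nullVec p 0 := by
  simp only [nullVec, Matrix.cons_val_zero]; positivity

lemma measurable_mink_nullVec (w : Fin 4 → ℝ) : Measurable fun p => mink w (nullVec p) := by
  refine Continuous.measurable ?_
  simp only [mink, nullVec]
  simp
  fun_prop

lemma mink_nullVec_eq {w : Fin 4 → ℝ} (hw : 0 < w 0 - w 3) (p : ℝ × ℝ) :
    mink w (nullVec p) =
      (w 0 - w 3) * ((p.1 - w 1 / (w 0 - w 3)) ^ 2 + (p.2 - w 2 / (w 0 - w 3)) ^ 2) +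
        mink w w / (w 0 - w 3) := by
  simp only [mink, nullVec]
  simp
  field_simp
  ring

lemma mink_nullVec_pos {w : Fin 4 → ℝ} (hw : 0 < w 0 - w 3) (hww : 0 < mink w w) (p : ℝ × ℝ) :
    0 < mink w (nullVec p) := by
  rw [mink_nullVec_eq hw]
  positivity

lemma sub_pos_of_mem_Lob {u : Fin 4 → ℝ} (hu : u ∈ Lob) : 0 < u 0 - u 3 := by
  obtain ⟨h, h0⟩ := hu
  simp only [mink] at h
  nlinarith [sq_nonneg (u 1), sq_nonneg (u 2), sq_nonneg (u 0 - u 3), sq_nonneg (u 3)]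

lemma one_le_mink {u v : Fin 4 → ℝ} (hu : u ∈ Lob) (hv : v ∈ Lob) : 1 ≤ mink u v := by
  obtain ⟨h, h0⟩ := hu
  obtain ⟨h', h0'⟩ := hv
  simp only [mink] at *
  have key : (1 + (u 1 * v 1 + u 2 * v 2 + u 3 * v 3)) ^ 2 ≤ (u 0 * v 0) ^ 2 := by
    have e : (u 0 * v 0) ^ 2 = (1 + (u 1 * u 1 + u 2 * u 2 + u 3 * u 3)) *
        (1 + (v 1 * v 1 + v 2 * v 2 + v 3 * v 3)) := by
      rw [show 1 + (u 1 * u 1 + u 2 * u 2 + u 3 * u 3) = u 0 * u 0 by linarith,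
        show 1 + (v 1 * v 1 + v 2 * v 2 + v 3 * v 3) = v 0 * v 0 by linarith]
      ring
    rw [e]
    nlinarith [sq_nonneg (u 1 * v 2 - u 2 * v 1), sq_nonneg (u 1 * v 3 - u 3 * v 1),
      sq_nonneg (u 2 * v 3 - u 3 * v 2), sq_nonneg (u 1 - v 1), sq_nonneg (u 2 - v 2),
      sq_nonneg (u 3 - v 3)]
  have := abs_le_of_sq_le_sq key (by positivity)
  linarith [le_abs_self (1 + (u 1 * v 1 + u 2 * v 2 + u 3 * v 3))]

lemma lintegral_Ioi_mul_inv_sq {a b : ℝ} (ha : 0 < a) (hb : 0 < b) :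
    ∫⁻ r in Ioi (0 : ℝ), ENNReal.ofReal (r * (1 / (a * r ^ 2 + b) ^ 2)) =
      ENNReal.ofReal (1 / (2 * a * b)) := by
  have hd : ∀ r ∈ Ici (0 : ℝ), HasDerivAt (fun r : ℝ => -(1 / (2 * a)) * (a * r ^ 2 + b)⁻¹)
      (r * (1 / (a * r ^ 2 + b) ^ 2)) r := by
    intro r _
    have hne : a * r ^ 2 + b ≠ 0 := by positivity
    have h := (((((hasDerivAt_id r).pow 2).const_mul a).add_const b).inv hne).const_mul
      (-(1 / (2 * a)))
    refine h.congr_deriv ?_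
    simp
    field_simp
  have hpos : ∀ r ∈ Ioi (0 : ℝ), 0 ≤ r * (1 / (a * r ^ 2 + b) ^ 2) := by
    intro r hr
    have : (0 : ℝ) < r := hr
    positivity
  have ht : Tendsto (fun r : ℝ => -(1 / (2 * a)) * (a * r ^ 2 + b)⁻¹) atTop (𝓝 0) := by
    rw [← mul_zero (-(1 / (2 * a)))]
    refine Tendsto.const_mul _ (tendsto_inv_atTop_zero.comp ?_)
    exact tendsto_atTop_add_const_right _ _
      ((tendsto_pow_atTop (two_ne_zero)).const_mul_atTop ha)
  rw [← ofReal_integral_eq_lintegral_ofReal (integrableOn_Ioi_deriv_of_nonneg' hd hpos ht)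
    ((ae_restrict_iff' measurableSet_Ioi).2 (ae_of_all _ hpos)),
    integral_Ioi_of_hasDerivAt_of_nonneg' hd hpos ht]
  congr 1
  simp
  field_simp

lemma lintegral_inv_sq_radial {a b : ℝ} (ha : 0 < a) (hb : 0 < b) :
    ∫⁻ p : ℝ × ℝ, ENNReal.ofReal (1 / (a * (p.1 ^ 2 + p.2 ^ 2) + b) ^ 2) =
      ENNReal.ofReal (Real.pi / (a * b)) := by
  rw [← lintegral_comp_polarCoord_symm]
  have e : ∀ p : ℝ × ℝ, p ∈ polarCoord.target →
      ENNReal.ofReal p.1 • ENNReal.ofReal (1 / (a * ((polarCoord.symm p).1 ^ 2 +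
        (polarCoord.symm p).2 ^ 2) + b) ^ 2) =
      ENNReal.ofReal (p.1 * (1 / (a * p.1 ^ 2 + b) ^ 2)) := by
    intro p hp
    have h0 : 0 < p.1 := by
      rw [polarCoord_target] at hp
      exact hp.1
    rw [smul_eq_mul, ← ENNReal.ofReal_mul h0.le]
    simp only [polarCoord_symm_apply]
    rw [show (p.1 * Real.cos p.2) ^ 2 + (p.1 * Real.sin p.2) ^ 2 = p.1 ^ 2 by
      rw [mul_pow, mul_pow, ← mul_add, Real.cos_sq_add_sin_sq, mul_one]]
  rw [setLIntegral_congr_fun polarCoord.open_target.measurableSet e, polarCoord_target,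
    Measure.volume_eq_prod, ← Measure.prod_restrict, lintegral_prod _ (by fun_prop)]
  simp only [lintegral_const, Measure.restrict_apply_univ, Real.volume_Ioo]
  rw [lintegral_mul_const _ (by fun_prop), lintegral_Ioi_mul_inv_sq ha hb,
    ← ENNReal.ofReal_mul (by positivity)]
  congr 1
  field_simp
  ring

lemma lintegral_inv_mink_nullVec_sq {w : Fin 4 → ℝ} (hw : 0 < w 0 - w 3) (hww : 0 < mink w w) :
    ∫⁻ p : ℝ × ℝ, ENNReal.ofReal (1 / mink w (nullVec p) ^ 2) =
      ENNReal.ofReal (Real.pi / mink w w) := by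
  have h := lintegral_inv_sq_radial hw (div_pos hww hw)
  rw [← lintegral_sub_right_eq_self _ ((w 1 / (w 0 - w 3), w 2 / (w 0 - w 3)) : ℝ × ℝ)] at h
  rw [mul_div_cancel₀ _ hw.ne'] at h
  simp only [mink_nullVec_eq hw]
  exact h

lemma lintegral_Ioc_of_hasDerivAt {g g' : ℝ → ℝ} (hd : ∀ s ∈ Icc (0 : ℝ) 1, HasDerivAt g (g' s) s)
    (hc : ContinuousOn g' (Icc 0 1)) (hpos : ∀ s ∈ Icc (0 : ℝ) 1, 0 ≤ g' s) :
    ∫⁻ s in Ioc (0 : ℝ) 1, ENNReal.ofReal (g' s) = ENNReal.ofReal (g 1 - g 0) := by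
  have hi : IntervalIntegrable g' volume 0 1 := by
    apply ContinuousOn.intervalIntegrable
    rwa [uIcc_of_le zero_le_one]
  have hi' : IntegrableOn g' (Ioc 0 1) :=
    (intervalIntegrable_iff_integrableOn_Ioc_of_le zero_le_one).1 hi
  rw [← ofReal_integral_eq_lintegral_ofReal hi'
    ((ae_restrict_iff' measurableSet_Ioc).2 (ae_of_all _ fun s hs => hpos s ⟨hs.1.le, hs.2⟩)),
    ← intervalIntegral.integral_of_le zero_le_one,
    intervalIntegral.integral_eq_sub_of_hasDerivAt (by rwa [uIcc_of_le zero_le_one]) hi]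

lemma convex_comb_pos {a b s : ℝ} (ha : 0 < a) (hb : 0 < b) (hs : s ∈ Icc (0 : ℝ) 1) :
    0 < s * a + (1 - s) * b := by
  obtain ⟨h0, h1⟩ := hs
  rcases h0.eq_or_lt with rfl | h0
  · simpa
  · have := mul_nonneg (sub_nonneg.2 h1) hb.le
    have := mul_pos h0 ha
    linarith

lemma hasDerivAt_convex_comb (a b s : ℝ) :
    HasDerivAt (fun s : ℝ => s * a + (1 - s) * b) (a - b) s := by
  refine (((hasDerivAt_id s).mul_const a).add
    (((hasDerivAt_id s).const_sub 1).mul_const b)).congr_deriv ?_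
  ring

/-- Feynman's parametrization of `1 / (a * b)`. -/
lemma lintegral_feynman {a b : ℝ} (ha : 0 < a) (hb : 0 < b) :
    ∫⁻ s in Ioc (0 : ℝ) 1, ENNReal.ofReal (1 / (s * a + (1 - s) * b) ^ 2) =
      ENNReal.ofReal (1 / (a * b)) := by
  have hne : ∀ s ∈ Icc (0 : ℝ) 1, s * a + (1 - s) * b ≠ 0 := fun s hs =>
    (convex_comb_pos ha hb hs).ne'
  rw [lintegral_Ioc_of_hasDerivAt (g := fun s => b⁻¹ * (s / (s * a + (1 - s) * b)))]
  · congr 1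
    simp
  · intro s hs
    have h0 := hne s hs
    refine (((hasDerivAt_id s).div (hasDerivAt_convex_comb a b s) h0).const_mul b⁻¹).congr_deriv ?_
    simp only [id]
    field_simp
    ring
  · exact ContinuousOn.div (by fun_prop) (by fun_prop) fun s hs => pow_ne_zero 2 (hne s hs)
  · intro s _
    positivity

lemma lintegral_inv_convex_comb_sq {l : ℝ} (hl : 0 < l) :
    ∫⁻ s in Ioc (0 : ℝ) 1,
        ENNReal.ofReal (1 / (s ^ 2 + (1 - s) ^ 2 + 2 * (s * (1 - s)) * Real.cosh l)) =
      ENNReal.ofReal (l / Real.sinh l) := by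
  have hsinh : 0 < Real.sinh l := Real.sinh_pos_iff.2 hl
  have hfac : ∀ s : ℝ, s ^ 2 + (1 - s) ^ 2 + 2 * (s * (1 - s)) * Real.cosh l =
      (s * 1 + (1 - s) * Real.exp l) * (s * 1 + (1 - s) * Real.exp (-l)) := by
    intro s
    have h : Real.exp l * Real.exp (-l) = 1 := by rw [← Real.exp_add]; simp
    rw [Real.cosh_eq]
    linear_combination (-(1 - s) ^ 2) * h
  have hp : ∀ s ∈ Icc (0 : ℝ) 1, 0 < s * 1 + (1 - s) * Real.exp l := fun s hs =>
    convex_comb_pos one_pos (Real.exp_pos _) hs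
  have hm : ∀ s ∈ Icc (0 : ℝ) 1, 0 < s * 1 + (1 - s) * Real.exp (-l) := fun s hs =>
    convex_comb_pos one_pos (Real.exp_pos _) hs
  simp only [hfac]
  rw [lintegral_Ioc_of_hasDerivAt (g := fun s => (2 * Real.sinh l)⁻¹ *
    (Real.log (s * 1 + (1 - s) * Real.exp (-l)) - Real.log (s * 1 + (1 - s) * Real.exp l)))]
  · congr 1
    simp
    field_simp
    ring
  · intro s hs
    have h1 := (hp s hs).ne'
    have h2 := (hm s hs).ne'
    refine ((((hasDerivAt_convex_comb 1 _ s).log h2).sub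
      ((hasDerivAt_convex_comb 1 _ s).log h1)).const_mul _).congr_deriv ?_
    have h3 : 2 * Real.sinh l = Real.exp l - Real.exp (-l) := by rw [Real.sinh_eq]; ring
    have h4 : Real.exp l - Real.exp (-l) ≠ 0 := by rw [← h3]; positivity
    rw [h3]
    generalize Real.exp l = x at *
    generalize Real.exp (-l) = y at *
    rw [div_sub_div _ _ h2 h1, inv_mul_eq_div, div_div, div_eq_div_iff (by positivity)
      (by positivity)]
    ring
  · exact ContinuousOn.div (by fun_prop) (by fun_prop) fun s hs =>
      (mul_pos (hp s hs) (hm s hs)).ne'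
  · intro s hs
    have := hp s hs
    have := hm s hs
    positivity

lemma lintegral_inv_mink_mul_mink {u v : Fin 4 → ℝ} (hu : u ∈ Lob) (hv : v ∈ Lob) :
    ∫⁻ p : ℝ × ℝ, ENNReal.ofReal (1 / (mink u (nullVec p) * mink v (nullVec p))) =
      ∫⁻ s in Ioc (0 : ℝ) 1, ENNReal.ofReal
        (Real.pi / (s ^ 2 + (1 - s) ^ 2 + 2 * (s * (1 - s)) * mink u v)) := by
  have huu : mink u u = 1 := hu.1
  have hvv : mink v v = 1 := hv.1
  have hup := mink_nullVec_pos (sub_pos_of_mem_Lob hu) (huu ▸ one_pos)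
  have hvp := mink_nullVec_pos (sub_pos_of_mem_Lob hv) (hvv ▸ one_pos)
  have hcu := measurable_mink_nullVec u
  have hcv := measurable_mink_nullVec v
  simp only [← lintegral_feynman (hup _) (hvp _)]
  have hcu' := hcu.comp (measurable_fst : Measurable (Prod.fst : (ℝ × ℝ) × ℝ → ℝ × ℝ))
  have hcv' := hcv.comp (measurable_fst : Measurable (Prod.fst : (ℝ × ℝ) × ℝ → ℝ × ℝ))
  rw [lintegral_lintegral_swap]
  swap
  · exact (ENNReal.measurable_ofReal.comp (((((measurable_snd.mul hcu').add
      ((measurable_snd.const_sub 1).mul hcv')).pow_const 2).const_div 1))).aemeasurable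
  refine setLIntegral_congr_fun measurableSet_Ioc fun s hs => ?_
  have hs' : s ∈ Icc (0 : ℝ) 1 := ⟨hs.1.le, hs.2⟩
  have hw : ∀ k, s * mink u k + (1 - s) * mink v k = mink (s • u + (1 - s) • v) k := by
    intro k
    simp [mink]
    ring
  have hww : mink (s • u + (1 - s) • v) (s • u + (1 - s) • v) =
      s ^ 2 + (1 - s) ^ 2 + 2 * (s * (1 - s)) * mink u v := by
    rw [← hw, mink_comm u, mink_comm v, ← hw, ← hw, huu, hvv, mink_comm v u]
    ring
  simp only [hw]
  rw [lintegral_inv_mink_nullVec_sq, hww]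
  · have := convex_comb_pos (sub_pos_of_mem_Lob hu) (sub_pos_of_mem_Lob hv) hs'
    simp
    linarith
  · rw [hww]
    have h1 := one_le_mink hu hv
    have h2 := mul_nonneg hs'.1 (sub_nonneg.2 hs'.2)
    nlinarith

lemma arcosh_nonneg {x : ℝ} (hx : 1 ≤ x) : 0 ≤ arcosh x :=
  Real.arcosh_nonneg hx

lemma cosh_arcosh {x : ℝ} (hx : 1 ≤ x) : Real.cosh (arcosh x) = x :=
  Real.cosh_arcosh hx

lemma lintegral_mink_div {u v : Fin 4 → ℝ} (hu : u ∈ Lob) (hv : v ∈ Lob) :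
    ∫⁻ p : ℝ × ℝ, ENNReal.ofReal (mink u v / (mink u (nullVec p) * mink v (nullVec p))) =
      ENNReal.ofReal (Real.pi * lcoth (arcosh (mink u v))) := by
  have h1 := one_le_mink hu hv
  have h0 : 0 ≤ mink u v := by linarith
  have hcu := measurable_mink_nullVec u
  have hcv := measurable_mink_nullVec v
  have hpi : ∀ y : ℝ, ENNReal.ofReal (Real.pi / y) =
      ENNReal.ofReal Real.pi * ENNReal.ofReal (1 / y) := fun y => by
    rw [← ENNReal.ofReal_mul Real.pi_pos.le, mul_one_div]
  simp only [← mul_one_div (mink u v), ENNReal.ofReal_mul h0]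
  rw [lintegral_const_mul _ (by fun_prop), lintegral_inv_mink_mul_mink hu hv]
  rcases (arcosh_nonneg h1).eq_or_lt with h | h
  · have hc : mink u v = 1 := by rw [← cosh_arcosh h1, ← h, Real.cosh_zero]
    have e : ∀ s : ℝ, s ^ 2 + (1 - s) ^ 2 + 2 * (s * (1 - s)) = 1 := fun s => by ring
    rw [← h]
    simp [lcoth, hc, e]
  · have hc := cosh_arcosh h1
    have hl := lintegral_inv_convex_comb_sq h
    rw [hc] at hl
    have hs : 0 < Real.sinh (arcosh (mink u v)) := Real.sinh_pos_iff.2 h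
    simp only [hpi]
    rw [lintegral_const_mul _ (by fun_prop), hl, lcoth, if_neg h.ne', hc,
      ← ENNReal.ofReal_mul Real.pi_pos.le, ← ENNReal.ofReal_mul h0]
    congr 1
    ring

lemma lcoth_nonneg {l : ℝ} (hl : 0 ≤ l) : 0 ≤ lcoth l := by
  rw [lcoth]
  split_ifs
  · exact zero_le_one
  · exact mul_nonneg hl (div_nonneg (Real.cosh_pos _).le (Real.sinh_nonneg_iff.2 hl))

lemma mink_div_nonneg {u v : Fin 4 → ℝ} (hu : u ∈ Lob) (hv : v ∈ Lob) (p : ℝ × ℝ) :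
    0 ≤ mink u v / (mink u (nullVec p) * mink v (nullVec p)) :=
  div_nonneg (zero_le_one.trans (one_le_mink hu hv))
    (mul_pos (mink_nullVec_pos (sub_pos_of_mem_Lob hu) (hu.1.symm ▸ one_pos) p)
      (mink_nullVec_pos (sub_pos_of_mem_Lob hv) (hv.1.symm ▸ one_pos) p)).le

lemma integrable_mink_div {u v : Fin 4 → ℝ} (hu : u ∈ Lob) (hv : v ∈ Lob) :
    Integrable fun p : ℝ × ℝ => mink u v / (mink u (nullVec p) * mink v (nullVec p)) := by
  have hcu := measurable_mink_nullVec u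
  have hcv := measurable_mink_nullVec v
  refine (lintegral_ofReal_ne_top_iff_integrable (Measurable.aestronglyMeasurable (by fun_prop))
    (ae_of_all _ (mink_div_nonneg hu hv))).1 ?_
  rw [lintegral_mink_div hu hv]
  exact ENNReal.ofReal_ne_top

lemma integral_mink_div {u v : Fin 4 → ℝ} (hu : u ∈ Lob) (hv : v ∈ Lob) :
    ∫ p : ℝ × ℝ, mink u v / (mink u (nullVec p) * mink v (nullVec p)) =
      Real.pi * lcoth (arcosh (mink u v)) := by
  rw [integral_eq_lintegral_of_nonneg_ae (ae_of_all _ (mink_div_nonneg hu hv))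
    (integrable_mink_div hu hv).aestronglyMeasurable, lintegral_mink_div hu hv,
    ENNReal.toReal_ofReal]
  exact mul_nonneg Real.pi_pos.le (lcoth_nonneg (arcosh_nonneg (one_le_mink hu hv)))

lemma Kker_comm (u v : Fin 4 → ℝ) : Kker u v = Kker v u := by
  rw [Kker, Kker, mink_comm]

lemma sum_sum_mul_Kker_nonpos {ι : Type*} [Fintype ι] (u : ι → Fin 4 → ℝ) (a : ι → ℝ)
    (hu : ∀ i, u i ∈ Lob) (ha : ∑ i, a i = 0) :
    ∑ i, ∑ j, a i * a j * Kker (u i) (u j) ≤ 0 := by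
  have hpos : ∀ i p, 0 < mink (u i) (nullVec p) := fun i =>
    mink_nullVec_pos (sub_pos_of_mem_Lob (hu i)) ((hu i).1.symm ▸ one_pos)
  have hint : ∑ i, ∑ j, a i * a j * (Real.pi * lcoth (arcosh (mink (u i) (u j)))) =
      ∫ p : ℝ × ℝ, ∑ i, ∑ j, a i * a j *
        (mink (u i) (u j) / (mink (u i) (nullVec p) * mink (u j) (nullVec p))) := by
    rw [integral_finsetSum _ fun i _ => integrable_finsetSum _ fun j _ =>
      (integrable_mink_div (hu i) (hu j)).const_mul _]
    refine Finset.sum_congr rfl fun i _ => ?_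
    rw [integral_finsetSum _ fun j _ => (integrable_mink_div (hu i) (hu j)).const_mul _]
    refine Finset.sum_congr rfl fun j _ => ?_
    rw [integral_const_mul, integral_mink_div (hu i) (hu j)]
  have hle : ∑ i, ∑ j, a i * a j * (Real.pi * lcoth (arcosh (mink (u i) (u j)))) ≤ 0 := by
    rw [hint]
    refine integral_nonpos fun p => ?_
    have hJ : mink (∑ i, (a i / mink (u i) (nullVec p)) • u i) (nullVec p) = 0 := by
      rw [mink_sum_smul_left, ← ha]
      exact Finset.sum_congr rfl fun i _ => div_mul_cancel₀ _ (hpos i p).ne'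
    have h := mink_self_nonpos_of_orthogonal_null (mink_nullVec_self p) (nullVec_zero_pos p) hJ
    rw [mink_sum_smul_left] at h
    simp only [mink_sum_smul_right, Finset.mul_sum] at h
    refine le_of_eq_of_le (Finset.sum_congr rfl fun i _ => Finset.sum_congr rfl fun j _ => ?_) h
    have := (hpos i p).ne'
    have := (hpos j p).ne'
    field_simp
  have hsplit : ∑ i, ∑ j, a i * a j * (Real.pi * lcoth (arcosh (mink (u i) (u j)))) =
      Real.pi * ∑ i, ∑ j, a i * a j * Kker (u i) (u j) := by
    have h1 : ∑ i, ∑ j, Real.pi * (a i * a j) = 0 := by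
      simp only [← Finset.mul_sum, ha, mul_zero, Finset.sum_const_zero]
    rw [← sub_eq_zero, ← h1]
    simp only [Finset.mul_sum, ← Finset.sum_sub_distrib, Kker]
    exact Finset.sum_congr rfl fun i _ => Finset.sum_congr rfl fun j _ => by ring
  rw [hsplit] at hle
  exact nonpos_of_mul_nonpos_right hle Real.pi_pos

/-- For a real symmetric kernel, the Hermitian form is the sum of the real quadratic forms of the
real and imaginary parts. -/
lemma sum_sum_conj_mul_symm {ι : Type*} [Fintype ι] (α : ι → ℂ) (K : ι → ι → ℝ)
    (hK : ∀ i j, K i j = K j i) :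
    ∑ i, ∑ j, (starRingEnd ℂ) (α i) * α j * (K i j : ℂ) =
      ((∑ i, ∑ j, (α i).re * (α j).re * K i j + ∑ i, ∑ j, (α i).im * (α j).im * K i j : ℝ) : ℂ) := by
  apply Complex.ext
  · simp [Finset.sum_add_distrib, add_mul]
  · have h : ∑ i, ∑ j, (α i).re * (α j).im * K i j = ∑ i, ∑ j, (α i).im * (α j).re * K i j := by
      rw [Finset.sum_comm]
      exact Finset.sum_congr rfl fun i _ => Finset.sum_congr rfl fun j _ => by rw [hK]; ring
    simp [Finset.sum_add_distrib, add_mul, h]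

/-- The kernel `K(u,v) = λ coth λ - 1` on the Lobachevsky space is symmetric,
vanishes on the diagonal, and is conditionally negative definite. -/
theorem Kker_conditionally_negative_definite :
    (∀ u ∈ Lob, ∀ v ∈ Lob, Kker u v = Kker v u) ∧
    (∀ u ∈ Lob, Kker u u = 0) ∧
    (∀ (n : ℕ) (u : Fin n → (Fin 4 → ℝ)) (α : Fin n → ℂ),
      (∀ i, u i ∈ Lob) → ∑ i, α i = 0 →
      ∑ i, ∑ j, (starRingEnd ℂ) (α i) * α j * (Kker (u i) (u j) : ℂ) ≤ 0) := by
  refine ⟨fun u _ v _ => Kker_comm u v, fun u hu => ?_, fun n u α hu hα => ?_⟩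
  · have h : mink u u = 1 := hu.1
    simp [Kker, h, arcosh, lcoth]
  · rw [sum_sum_conj_mul_symm α (fun i j => Kker (u i) (u j)) fun i j => Kker_comm _ _]
    have hre : ∑ i, (α i).re = 0 := by rw [← Complex.re_sum, hα, Complex.zero_re]
    have him : ∑ i, (α i).im = 0 := by rw [← Complex.im_sum, hα, Complex.zero_im]
    exact_mod_cast add_nonpos (sum_sum_mul_Kker_nonpos u _ hu hre)
      (sum_sum_mul_Kker_nonpos u _ hu him)
end

section
/- Schoenberg's theorem: Let X be a set and K : X × X → ℝ a symmetric kernel with K(x,x) = 0 for all x. If K is conditionally negative definite (i.e., Σᵢⱼ \overline{αᵢ}αⱼ K(xᵢ,xⱼ) ≤ 0 for all finite families xᵢ ∈ X, αᵢ ∈ ℂ with Σαᵢ = 0), then for every t > 0 the kernel (x,y) ↦ exp(-t K(x,y)) is positive definite (Σᵢⱼ \overline{αᵢ}αⱼ e^{-tK(xᵢ,xⱼ)} ≥ 0 for all finite families xᵢ, αᵢ). -/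
open scoped ComplexOrder

namespace Matrix

theorem posSemidef_iff_sum_nonneg {ι : Type*} [Fintype ι] {A : Matrix ι ι ℂ} :
    A.PosSemidef ↔ A.IsHermitian ∧
      ∀ v : ι → ℂ, 0 ≤ ∑ i, ∑ j, (starRingEnd ℂ) (v i) * v j * A i j := by
  have h (v : ι → ℂ) : star v ⬝ᵥ A.mulVec v =
      ∑ i, ∑ j, (starRingEnd ℂ) (v i) * v j * A i j := by
    simp only [dotProduct, mulVec, Finset.mul_sum, Pi.star_apply]
    refine Finset.sum_congr rfl fun i _ => Finset.sum_congr rfl fun j _ => ?_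
    rw [starRingEnd_apply]
    ring
  simp only [posSemidef_iff_dotProduct_mulVec, h]

theorem PosSemidef.map_pow {ι : Type*} [Fintype ι] {A : Matrix ι ι ℂ}
    (hA : A.PosSemidef) (k : ℕ) : (A.map (· ^ k)).PosSemidef := by
  induction k with
  | zero =>
    convert posSemidef_vecMulVec_self_star (1 : ι → ℂ)
    ext i j
    simp [vecMulVec_apply]
  | succ k ih =>
    have h : A.map (· ^ (k + 1)) = (A.map (· ^ k)).hadamard A := by
      ext i j
      simp [pow_succ]
    rw [h]
    exact ih.hadamard hA

/-- The entrywise exponential of a positive semidefinite matrix is positive semidefinite. -/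
theorem PosSemidef.map_exp {ι : Type*} [Fintype ι] {A : Matrix ι ι ℂ}
    (hA : A.PosSemidef) : (A.map Complex.exp).PosSemidef := by
  refine posSemidef_iff_sum_nonneg.2 ⟨?_, fun v => ?_⟩
  · ext i j
    simp [← Complex.exp_conj, ← hA.isHermitian.apply i j]
  · have hexp (z : ℂ) : HasSum (fun k : ℕ => (k.factorial : ℂ)⁻¹ * z ^ k) (Complex.exp z) := by
      simpa [Complex.exp_eq_exp_ℂ] using NormedSpace.exp_series_hasSum_exp' (𝕂 := ℂ) z
    refine HasSum.nonneg (fun k => ?_) (hasSum_sum fun i _ => hasSum_sum fun j _ =>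
      (hexp (A i j)).mul_left ((starRingEnd ℂ) (v i) * v j))
    have hk := (posSemidef_iff_sum_nonneg.1 (hA.map_pow k)).2 v
    have hc : (0 : ℂ) ≤ (k.factorial : ℂ)⁻¹ := by positivity
    convert mul_nonneg hc hk using 1
    simp only [Finset.mul_sum, map_apply]
    refine Finset.sum_congr rfl fun i _ => Finset.sum_congr rfl fun j _ => ?_
    ring

end Matrix

/-- The matrix `K(xᵢ, y) + K(y, xⱼ) - K(xᵢ, xⱼ)` of a conditionally negative definite kernel
with base point `y` is positive semidefinite. -/
theorem posSemidef_of_conditionally_negative_definite {X : Type*} (K : X → X → ℝ)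
    (hsymm : ∀ x y, K x y = K y x)
    (hdiag : ∀ x, K x x = 0)
    (hcnd : ∀ (n : ℕ) (x : Fin n → X) (α : Fin n → ℂ),
      ∑ i, α i = 0 →
      ∑ i, ∑ j, (starRingEnd ℂ) (α i) * α j * (K (x i) (x j) : ℂ) ≤ 0)
    (y : X) (n : ℕ) (x : Fin n → X) :
    (Matrix.of fun i j => ((K (x i) y + K y (x j) - K (x i) (x j) : ℝ) : ℂ)).PosSemidef := by
  refine Matrix.posSemidef_iff_sum_nonneg.2 ⟨?_, fun v => ?_⟩
  · ext i j
    simp only [Matrix.conjTranspose_apply, Matrix.of_apply, ← starRingEnd_apply,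
      Complex.conj_ofReal]
    rw [hsymm (x j) y, hsymm y (x i), hsymm (x j) (x i)]
    push_cast
    ring
  · have h := hcnd (n + 1) (Fin.cons y x) (Fin.cons (-∑ i, v i) v) (by simp [Fin.sum_univ_succ])
    simp only [Fin.sum_univ_succ, Fin.cons_zero, Fin.cons_succ, hdiag, Complex.ofReal_zero,
      mul_zero, zero_add, Finset.sum_add_distrib] at h
    rw [← neg_nonneg] at h
    convert h using 1
    simp only [map_neg, map_sum, neg_mul, mul_neg, Finset.sum_mul, Finset.mul_sum,
      Finset.sum_neg_distrib, Matrix.of_apply]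
    rw [Finset.sum_comm (f := fun j i => (starRingEnd ℂ) (v i) * v j * (K y (x j) : ℂ))]
    rw [neg_add, neg_add, neg_neg, neg_neg]
    simp only [← Finset.sum_add_distrib, ← Finset.sum_neg_distrib]
    refine Finset.sum_congr rfl fun i _ => Finset.sum_congr rfl fun j _ => ?_
    push_cast
    ring

/-- **Schoenberg's theorem.** If `K : X × X → ℝ` is a symmetric kernel vanishing
on the diagonal which is conditionally negative definite, then for every `t > 0`
the kernel `(x, y) ↦ exp (-t K x y)` is positive definite. -/
theorem schoenberg {X : Type*} (K : X → X → ℝ)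
    (hsymm : ∀ x y, K x y = K y x)
    (hdiag : ∀ x, K x x = 0)
    (hcnd : ∀ (n : ℕ) (x : Fin n → X) (α : Fin n → ℂ),
      ∑ i, α i = 0 →
      ∑ i, ∑ j, (starRingEnd ℂ) (α i) * α j * (K (x i) (x j) : ℂ) ≤ 0) :
    ∀ t : ℝ, 0 < t →
      ∀ (n : ℕ) (x : Fin n → X) (α : Fin n → ℂ),
        (0 : ℂ) ≤ ∑ i, ∑ j, (starRingEnd ℂ) (α i) * α j *
          (Real.exp (-t * K (x i) (x j)) : ℂ) := by
  intro t ht n x α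
  rcases n with _ | n
  · simp
  have hG := ((posSemidef_of_conditionally_negative_definite K hsymm hdiag hcnd (x 0) _ x).smul
    (Complex.zero_le_real.2 ht.le)).map_exp
  convert (Matrix.posSemidef_iff_sum_nonneg.1 hG).2
    (fun i => α i * (Real.exp (-t * K (x i) (x 0)) : ℂ)) using 1
  refine Finset.sum_congr rfl fun i _ => Finset.sum_congr rfl fun j _ => ?_
  have h : (Real.exp (-t * K (x i) (x j)) : ℂ) = Real.exp (-t * K (x i) (x 0)) *
      Real.exp (-t * K (x j) (x 0)) *
      Complex.exp (t * ((K (x i) (x 0) + K (x 0) (x j) - K (x i) (x j) : ℝ) : ℂ)) := by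
    rw [hsymm (x 0) (x j)]
    push_cast
    rw [← Complex.exp_add, ← Complex.exp_add]
    congr 1
    ring
  simp only [h, map_mul, Complex.conj_ofReal, Matrix.map_apply, Matrix.smul_apply,
    Matrix.of_apply, smul_eq_mul]
  ring
end
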